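/- arXiv:1309.1088 — 2 statements merged into one kernel-verified Lean document; each statement's English description precedes it below -/
import Mathlib

section
/- Let Λ be a self-injective ring and let M be a Λ-module that is Ω-periodic, i.e. there exist an integer n ≥ 1 and an exact sequence of Λ-modules 0 → M → P_{n-1} → ⋯ → P₁ → P₀ → M → 0 in which every P_i is projective. If Ext^i(M,M) = 0 for all sufficiently large i, then M is projective. (This is the homological core of the theorem that over a symmetric artin algebra any module with eventually vanishing self-extensions lying in an AR component containing a τ-periodic module must be projective.) -/
open CategoryTheory

universe u

/-- The `i`-th Ext group of the `Λ`-modules `M` and `N`. -/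
noncomputable abbrev extGroup (Λ : Type u) [Ring Λ] (i : ℕ) (M N : ModuleCat.{u} Λ) : Type u :=
  ((Ext ℤ (ModuleCat.{u} Λ) i).obj (Opposite.op M)).obj N

/-- `K` is a (first) syzygy of `M`: there is a short exact sequence `0 → K → P → M → 0`
with `P` projective. -/
def IsSyzygyOf {Λ : Type u} [Ring Λ] (K M : ModuleCat.{u} Λ) : Prop :=
  ∃ (P : ModuleCat.{u} Λ) (_ : Projective P) (f : K ⟶ P) (g : P ⟶ M),
    Function.Injective f ∧ Function.Exact f g ∧ Function.Surjective g

/-- `K` is an `n`-th syzygy of `M`, i.e. there is an exact sequence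
`0 → K → P_{n-1} → ⋯ → P₀ → M → 0` with all `P_i` projective. -/
def IsNthSyzygyOf {Λ : Type u} [Ring Λ] : ℕ → ModuleCat.{u} Λ → ModuleCat.{u} Λ → Prop
  | 0, K, M => Nonempty (K ≅ M)
  | n + 1, K, M => ∃ K' : ModuleCat.{u} Λ, IsSyzygyOf K' M ∧ IsNthSyzygyOf n K K'

/-- Vanishing of the derived-functor `Ext` implies vanishing of `Abelian.Ext`. -/
lemma subsingleton_abelianExt {Λ : Type u} [Ring Λ] (i : ℕ) (M N : ModuleCat.{u} Λ)
    (h : Subsingleton (extGroup Λ (i + 1) M N)) :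
    Subsingleton (Abelian.Ext.{u} M N (i + 1)) := by
  let R := ProjectiveResolution.of M
  have hz : Limits.IsZero (((Ext ℤ (ModuleCat.{u} Λ) (i + 1)).obj (Opposite.op M)).obj N) :=
    ModuleCat.isZero_of_subsingleton _
  have hz' := hz.of_iso (R.isoExt (R := ℤ) (i + 1) N).symm
  rw [← HomologicalComplex.exactAt_iff_isZero_homology,
    HomologicalComplex.exactAt_iff' _ i (i + 1) (i + 2) (by simp) (by simp),
    ShortComplex.moduleCat_exact_iff] at hz'
  refine subsingleton_of_forall_eq 0 fun α => ?_
  obtain ⟨f, hf, rfl⟩ := R.extMk_surjective α (i + 2) rfl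
  rw [R.extMk_eq_zero_iff f (i + 2) rfl hf i rfl]
  obtain ⟨g, hg⟩ := hz' f hf
  exact ⟨g, hg⟩

lemma syzygy_shift {Λ : Type u} [Ring Λ] {K M : ModuleCat.{u} Λ} (h : IsSyzygyOf K M)
    (Y : ModuleCat.{u} Λ) (i : ℕ) (hM : Subsingleton (Abelian.Ext.{u} M Y (i + 2))) :
    Subsingleton (Abelian.Ext.{u} K Y (i + 1)) := by
  obtain ⟨P, hP, f, g, hf, hfg, hg⟩ := h
  let S : ShortComplex (ModuleCat.{u} Λ) := ShortComplex.mk f g (by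
    ext x; exact hfg.apply_apply_eq_zero x)
  have hS : S.ShortExact :=
    { exact := (ShortComplex.ShortExact.moduleCat_exact_iff_function_exact S).2 hfg
      mono_f := (ModuleCat.mono_iff_injective _).2 hf
      epi_g := (ModuleCat.epi_iff_surjective _).2 hg }
  refine subsingleton_of_forall_eq 0 fun α => ?_
  obtain ⟨x₂, rfl⟩ := Abelian.Ext.contravariant_sequence_exact₁ hS Y α (n₁ := i + 2) (by omega)
    (hM.elim _ _)
  have : Projective S.X₂ := hP
  rw [Abelian.Ext.eq_zero_of_projective x₂]
  simp

lemma syzygy_projective {Λ : Type u} [Ring Λ] {K M : ModuleCat.{u} Λ} (h : IsSyzygyOf K M)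
    (hM : Subsingleton (Abelian.Ext.{u} M K 1)) : Projective K := by
  obtain ⟨P, hP, f, g, hf, hfg, hg⟩ := h
  let S : ShortComplex (ModuleCat.{u} Λ) := ShortComplex.mk f g (by
    ext x; exact hfg.apply_apply_eq_zero x)
  have hS : S.ShortExact :=
    { exact := (ShortComplex.ShortExact.moduleCat_exact_iff_function_exact S).2 hfg
      mono_f := (ModuleCat.mono_iff_injective _).2 hf
      epi_g := (ModuleCat.epi_iff_surjective _).2 hg }
  obtain ⟨x₂, hx⟩ := Abelian.Ext.contravariant_sequence_exact₁ hS K (Abelian.Ext.mk₀ (𝟙 K))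
    (n₁ := 1) (by omega) (hM.elim _ _)
  obtain ⟨r, rfl⟩ := Abelian.Ext.homEquiv₀.symm.surjective x₂
  have hr : f ≫ r = 𝟙 K := by
    apply Abelian.Ext.homEquiv₀.symm.injective
    simpa [S] using hx
  exact Retract.projective ⟨f, r, hr⟩

lemma nthSyzygy_shift {Λ : Type u} [Ring Λ] (Y K : ModuleCat.{u} Λ) (i n : ℕ) :
    ∀ M : ModuleCat.{u} Λ, IsNthSyzygyOf n K M →
      Subsingleton (Abelian.Ext.{u} M Y (i + 1 + n)) →
      Subsingleton (Abelian.Ext.{u} K Y (i + 1)) := by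
  induction n with
  | zero =>
    rintro M ⟨e⟩ hM
    refine subsingleton_of_forall_eq 0 fun α => ?_
    have : α = (Abelian.Ext.mk₀ e.hom).comp ((Abelian.Ext.mk₀ e.inv).comp α (zero_add _))
        (zero_add _) := by simp
    rw [this, hM.elim ((Abelian.Ext.mk₀ e.inv).comp α (zero_add _)) 0]
    simp
  | succ n ih =>
    rintro M ⟨K', h1, h2⟩ hM
    refine ih K' h2 ?_
    rw [show i + 1 + n = (i + n) + 1 by omega]
    refine syzygy_shift h1 Y (i + n) ?_
    rwa [show i + n + 2 = i + 1 + (n + 1) by omega]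

lemma nthSyzygy_projective {Λ : Type u} [Ring Λ] (K : ModuleCat.{u} Λ) (n : ℕ) :
    ∀ M : ModuleCat.{u} Λ, IsNthSyzygyOf (n + 1) K M →
      Subsingleton (Abelian.Ext.{u} M K (n + 1)) → Projective K := by
  induction n with
  | zero =>
    rintro M ⟨K', ⟨P, hP, f, g, hf, hfg, hg⟩, ⟨e⟩⟩ hM
    refine syzygy_projective (M := M) ⟨P, hP, e.hom ≫ f, g, ?_, ?_, hg⟩ hM
    · have he : Function.Injective e.hom := (ModuleCat.mono_iff_injective _).1 inferInstance
      simpa using hf.comp he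
    · have he : Function.Surjective e.hom := (ModuleCat.epi_iff_surjective _).1 inferInstance
      intro y
      rw [hfg y]
      constructor
      · rintro ⟨x, rfl⟩
        obtain ⟨z, rfl⟩ := he x
        exact ⟨z, rfl⟩
      · rintro ⟨z, rfl⟩
        exact ⟨e.hom z, rfl⟩
  | succ n ih =>
    rintro M ⟨K', h1, h2⟩ hM
    exact ih K' h2 (syzygy_shift h1 K n hM)

/-- Let `Λ` be a self-injective ring and `M` an `Ω`-periodic `Λ`-module, i.e. there are `n ≥ 1`
and an exact sequence `0 → M → P_{n-1} → ⋯ → P₀ → M → 0` with all `P_i` projective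
(equivalently, `M` is an `n`-th syzygy of itself).  If `Ext^i(M,M) = 0` for all sufficiently
large `i`, then `M` is projective. -/
theorem stmt_6 (Λ : Type u) [Ring Λ]
    (selfinj : Module.Injective Λ Λ)
    (M : ModuleCat.{u} Λ)
    (n : ℕ) (hn : 1 ≤ n) (hper : IsNthSyzygyOf n M M)
    (hvan : ∃ N₀, ∀ i, N₀ ≤ i → Subsingleton (extGroup Λ i M M)) :
    Projective M := by
  obtain ⟨N₀, hN⟩ := hvan
  obtain ⟨m, rfl⟩ : ∃ m, n = m + 1 := ⟨n - 1, by omega⟩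
  have key : ∀ k i, N₀ ≤ i + k → Subsingleton (Abelian.Ext.{u} M M (i + 1)) := by
    intro k
    induction k with
    | zero => exact fun i hi => subsingleton_abelianExt i M M (hN _ (by omega))
    | succ k ih =>
      intro i hi
      refine nthSyzygy_shift M M i (m + 1) M hper ?_
      rw [show i + 1 + (m + 1) = (i + 1 + m) + 1 by omega]
      exact ih _ (by omega)
  exact nthSyzygy_projective M m M hper (key N₀ m (by omega))
end

section
/- Let Λ be a self-injective ring satisfying the Generalized Auslander-Reiten Condition: for every finitely generated Λ-module M and every integer n ≥ 0, if Ext^i(M, M ⊕ Λ) = 0 for all i > n then the projective dimension of M is at most n. Then the Extension Conjecture holds for Λ: every finitely generated simple Λ-module S with Ext^1(S,S) ≠ 0 satisfies Ext^i(S,S) ≠ 0 for infinitely many integers i ≥ 1. -/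
open CategoryTheory CategoryTheory.Limits

universe u

/-- `M` has projective dimension at most `n`: there is a projective resolution
`0 → P_n → ⋯ → P₀ → M → 0` of length `n`, i.e. some `n`-th syzygy of `M` is projective. -/
def HasProjDimLE {Λ : Type u} [Ring Λ] (M : ModuleCat.{u} Λ) (n : ℕ) : Prop :=
  ∃ K : ModuleCat.{u} Λ, IsNthSyzygyOf n K M ∧ Projective K

/-- The derived-functor Ext and the derived-category Ext vanish together in positive degrees. -/
theorem ext_bridge {Λ : Type u} [Ring Λ] (p : ℕ) (M N : ModuleCat.{u} Λ) :
    Subsingleton (extGroup Λ (p+1) M N) ↔ Subsingleton (Abelian.Ext.{u} M N (p+1)) := by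
  let R := projectiveResolution M
  have h1 : Subsingleton (extGroup Λ (p+1) M N) ↔
    ∀ f : R.complex.X (p+1) ⟶ N, R.complex.d (p+2) (p+1) ≫ f = 0 →
      ∃ g : R.complex.X p ⟶ N, R.complex.d (p+1) p ≫ g = f := by
    rw [← ModuleCat.isZero_iff_subsingleton]
    rw [(R.isoExt (R := ℤ) (p+1) N).isZero_iff, ← HomologicalComplex.exactAt_iff_isZero_homology,
      HomologicalComplex.exactAt_iff' _ p (p+1) (p+2) (by simp) (by simp),
      ShortComplex.moduleCat_exact_iff]
    rfl
  rw [h1]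
  constructor
  · intro h
    suffices ∀ a : Abelian.Ext.{u} M N (p+1), a = 0 from ⟨fun a b => by rw [this a, this b]⟩
    intro a
    obtain ⟨f, hf, rfl⟩ := R.extMk_surjective a (p+2) rfl
    rw [R.extMk_eq_zero_iff f (p+2) rfl hf p rfl]
    exact h f hf
  · intro h f hf
    rw [← R.extMk_eq_zero_iff f (p+2) rfl hf p rfl]
    exact Subsingleton.elim _ _

theorem ext_biprod {Λ : Type u} [Ring Λ] (p : ℕ) (M A B : ModuleCat.{u} Λ)
    (hA : Subsingleton (Abelian.Ext.{u} M A p)) (hB : Subsingleton (Abelian.Ext.{u} M B p)) :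
    Subsingleton (Abelian.Ext.{u} M (A ⊞ B) p) := by
  suffices ∀ a : Abelian.Ext.{u} M (A ⊞ B) p, a = 0 from ⟨fun a b => by rw [this a, this b]⟩
  intro a
  have hs := (ShortComplex.Splitting.ofHasBinaryBiproduct A B).shortExact
  obtain ⟨x, rfl⟩ := Abelian.Ext.covariant_sequence_exact₂ M hs a (Subsingleton.elim _ _)
  have : x = 0 := hA.elim _ _
  simp [this]

theorem hasProjLT {Λ : Type u} [Ring Λ] (n : ℕ) (M : ModuleCat.{u} Λ) (h : HasProjDimLE M n) :
    HasProjectiveDimensionLT M (n+1) := by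
  induction n generalizing M with
  | zero =>
    obtain ⟨K, ⟨e⟩, hK⟩ := h
    exact hasProjectiveDimensionLT_of_iso e 1
  | succ n ih =>
    obtain ⟨K, ⟨K', ⟨P, hP, f, g, hf, hfg, hg⟩, hn⟩, hK⟩ := h
    have h' := ih K' ⟨K, hn, hK⟩
    have w : f ≫ g = 0 := by
      ext x
      exact hfg.apply_apply_eq_zero x
    have hs : (ShortComplex.mk f g w).ShortExact :=
      { exact := by
          rw [ShortComplex.moduleCat_exact_iff]
          intro x hx
          exact (hfg x).1 hx
        mono_f := (ModuleCat.mono_iff_injective _).2 hf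
        epi_g := (ModuleCat.epi_iff_surjective _).2 hg }
    exact (hs.hasProjectiveDimensionLT_X₃_iff n hP).2 h'

theorem ext_injective {Λ : Type u} [Ring Λ] (p : ℕ) (M N : ModuleCat.{u} Λ) [Injective N] :
    Subsingleton (Abelian.Ext.{u} M N (p+1)) :=
  HasInjectiveDimensionLT.subsingleton N 1 (p+1) (by omega) M

theorem ext_top {Λ : Type u} [Ring Λ] (n : ℕ) (M A N : ModuleCat.{u} Λ)
    (h : HasProjectiveDimensionLT M (n+1)) (g : A ⟶ N) (hg : Epi g)
    (hA : Subsingleton (Abelian.Ext.{u} M A n)) :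
    Subsingleton (Abelian.Ext.{u} M N n) := by
  suffices ∀ a : Abelian.Ext.{u} M N n, a = 0 from ⟨fun a b => by rw [this a, this b]⟩
  intro a
  have hs : (ShortComplex.mk (kernel.ι g) g (kernel.condition g)).ShortExact :=
    { exact := ShortComplex.exact_kernel g }
  obtain ⟨x, rfl⟩ := Abelian.Ext.covariant_sequence_exact₃ M hs a rfl
    (Abelian.Ext.eq_zero_of_hasProjectiveDimensionLT _ (n+1) le_rfl)
  have : x = 0 := hA.elim _ _
  simp [this]


/-- Let `Λ` be a self-injective ring satisfying the Generalized Auslander-Reiten Condition: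
for every finitely generated `Λ`-module `M` and every `n ≥ 0`, if `Ext^i(M, M ⊕ Λ) = 0` for
all `i > n` then the projective dimension of `M` is at most `n`.  Then the Extension
Conjecture holds for `Λ`: every finitely generated simple `Λ`-module `S` with
`Ext^1(S,S) ≠ 0` satisfies `Ext^i(S,S) ≠ 0` for infinitely many `i ≥ 1`. -/
theorem stmt_11 (Λ : Type u) [Ring Λ]
    (selfinj : Module.Injective Λ Λ)
    (garc : ∀ (M : ModuleCat.{u} Λ), Module.Finite Λ M → ∀ n : ℕ,
      (∀ i, n < i → Subsingleton (extGroup Λ i M (M ⊞ ModuleCat.of Λ Λ))) →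
      HasProjDimLE M n)
    (S : ModuleCat.{u} Λ) (hfin : Module.Finite Λ S) (hsimple : IsSimpleModule Λ S)
    (h1 : ¬ Subsingleton (extGroup Λ 1 S S)) :
    {i : ℕ | 1 ≤ i ∧ ¬ Subsingleton (extGroup Λ i S S)}.Infinite := by
  intro hfinite
  have : Injective (ModuleCat.of Λ Λ) := Module.injective_object_of_injective_module Λ Λ
  obtain ⟨N, hN⟩ := hfinite.bddAbove
  have hSS : ∀ i, N < i → Subsingleton (Abelian.Ext.{u} S S i) := by
    intro i hi
    obtain ⟨p, rfl⟩ : ∃ p, i = p + 1 := ⟨i - 1, by omega⟩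
    rw [← ext_bridge]
    by_contra hc
    have := hN (show p + 1 ∈ {i : ℕ | 1 ≤ i ∧ ¬ Subsingleton (extGroup Λ i S S)} from
      ⟨by omega, hc⟩)
    omega
  have key : ∀ n, (∀ i, n < i → Subsingleton (Abelian.Ext.{u} S S i)) →
      HasProjectiveDimensionLT S (n+1) := by
    intro n h
    refine hasProjLT n S (garc S hfin n ?_)
    intro i hi
    obtain ⟨p, rfl⟩ : ∃ p, i = p + 1 := ⟨i - 1, by omega⟩
    rw [ext_bridge]
    exact ext_biprod _ _ _ _ (h _ hi) (ext_injective _ _ _)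
  have hnt := IsSimpleModule.nontrivial Λ S
  obtain ⟨s, hs⟩ := exists_ne (0 : S)
  have hg : Epi (ModuleCat.ofHom (LinearMap.toSpanSingleton Λ S s)) :=
    (ModuleCat.epi_iff_surjective _).2 (IsSimpleModule.toSpanSingleton_surjective Λ hs)
  have down : ∀ n, HasProjectiveDimensionLT S (n+1) → HasProjectiveDimensionLT S 1 := by
    intro n
    induction n with
    | zero => exact id
    | succ n ih =>
      intro h
      refine ih (key n fun i hi => ?_)
      rcases Nat.lt_or_ge (n+1) i with h' | h'
      · exact HasProjectiveDimensionLT.subsingleton S (n+1+1) i h' S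
      · obtain rfl : i = n + 1 := by omega
        exact ext_top _ _ _ _ h _ hg (ext_injective _ _ _)
  have := down N (key N hSS)
  exact h1 ((ext_bridge 0 S S).2 (HasProjectiveDimensionLT.subsingleton S 1 1 le_rfl S))
end
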